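/- Let L > 0 and let (η_t)_{t≥0} be nonnegative stepsizes such that for infinitely many T ∈ ℕ one has η_T ≥ 2/L, ∑_{t=0}^{T−1} η_t ≥ 1/L, and (η_T / ∑_{t=0}^{T−1} η_t)² ≥ 1. Then for infinitely many S ∈ ℕ there exist a convex L-smooth function f : ℝ → ℝ, a global minimizer x* of f, and an initialization x₀ ∈ ℝ such that the gradient descent iterates satisfy f(x_S) − f(x*) ≥ (1/32)·L·(x₀ − x*)². -/

import Mathlib

/-- The antiderivative, vanishing at `0`, of the clipped linear function `s ↦ L * min s 1`:
quadratic on `(-∞, 1]` and affine on `[1, ∞)`. -/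
noncomputable def oneSidedHuber (L x : ℝ) : ℝ := ∫ s in (0 : ℝ)..x, L * min s 1

namespace oneSidedHuber

lemma hasDerivAt (L x : ℝ) : HasDerivAt (oneSidedHuber L) (L * min x 1) x := by
  have hc : Continuous fun s : ℝ => L * min s 1 := by fun_prop
  exact intervalIntegral.integral_hasDerivAt_right (hc.intervalIntegrable _ _)
    (hc.stronglyMeasurableAtFilter _ _) hc.continuousAt

lemma deriv_eq (L x : ℝ) : deriv (oneSidedHuber L) x = L * min x 1 :=
  (hasDerivAt L x).deriv

lemma differentiable (L : ℝ) : Differentiable ℝ (oneSidedHuber L) :=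
  fun x => (hasDerivAt L x).differentiableAt

lemma eq_of_le_one (L : ℝ) {x : ℝ} (hx : x ≤ 1) : oneSidedHuber L x = L / 2 * x ^ 2 := by
  have h : Set.EqOn (fun s : ℝ => L * min s 1) (fun s => L * s) (Set.uIcc 0 x) := by
    intro s hs
    have hs1 : s ≤ 1 := hs.2.trans (sup_le zero_le_one hx)
    simp only [min_eq_left hs1]
  rw [oneSidedHuber, intervalIntegral.integral_congr h, intervalIntegral.integral_const_mul,
    integral_id]
  ring

lemma convexOn {L : ℝ} (hL : 0 ≤ L) : ConvexOn ℝ Set.univ (oneSidedHuber L) := by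
  refine Monotone.convexOn_univ_of_deriv (differentiable L) fun y z hyz => ?_
  rw [deriv_eq, deriv_eq]
  gcongr

lemma abs_deriv_sub_le {L : ℝ} (hL : 0 ≤ L) (y z : ℝ) :
    |deriv (oneSidedHuber L) y - deriv (oneSidedHuber L) z| ≤ L * |y - z| := by
  rw [deriv_eq, deriv_eq, ← mul_sub, abs_mul, abs_of_nonneg hL]
  refine mul_le_mul_of_nonneg_left ?_ hL
  simpa using abs_min_sub_min_le_max y 1 z 1

lemma nonneg {L : ℝ} (hL : 0 ≤ L) (x : ℝ) : 0 ≤ oneSidedHuber L x := by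
  rcases le_total x 1 with hx | hx
  · rw [eq_of_le_one L hx]
    positivity
  · refine intervalIntegral.integral_nonneg (zero_le_one.trans hx) fun s hs => ?_
    exact mul_nonneg hL (le_min hs.1 zero_le_one)

end oneSidedHuber

/-- While gradient descent on `oneSidedHuber L` has not left the affine part, it moves at
constant slope `L`. -/
lemma oneSidedHuber_gd_eq {L : ℝ} (hL : 0 ≤ L) {η x : ℕ → ℝ} (hη : ∀ t, 0 ≤ η t) {T : ℕ}
    (hx₀ : x 0 = 1 + L * ∑ t ∈ Finset.range T, η t)
    (hx : ∀ t, x (t + 1) = x t - η t * deriv (oneSidedHuber L) (x t)) :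
    ∀ t ≤ T, x t = x 0 - L * ∑ s ∈ Finset.range t, η s := by
  intro t
  induction t with
  | zero => simp
  | succ t ih =>
    intro ht
    have hxt := ih (Nat.le_of_succ_le ht)
    have hsum : ∑ s ∈ Finset.range t, η s ≤ ∑ s ∈ Finset.range T, η s :=
      Finset.sum_le_sum_of_subset_of_nonneg
        (Finset.range_mono (Nat.le_of_succ_le ht)) fun i _ _ => hη i
    have h1 : 1 ≤ x t := by
      rw [hxt, hx₀]
      linarith [mul_le_mul_of_nonneg_left hsum hL]
    rw [hx, oneSidedHuber.deriv_eq, min_eq_right h1, hxt, Finset.sum_range_succ]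
    ring

/-- A long step `η T` that dominates the sum of all earlier steps forces a constant error at time
`T + 1`, for some instance not initialized at the minimizer. -/
theorem gd_constant_error_of_long_step
    {L : ℝ} (hL : 0 < L) {η : ℕ → ℝ} (hη : ∀ t, 0 ≤ η t) {T : ℕ} (hlong : 2 / L ≤ η T)
    (hsum : 1 / L ≤ ∑ t ∈ Finset.range T, η t) (hratio : ∑ t ∈ Finset.range T, η t ≤ η T) :
    ∃ f : ℝ → ℝ, ConvexOn ℝ Set.univ f ∧ Differentiable ℝ f ∧
      (∀ y z : ℝ, |deriv f y - deriv f z| ≤ L * |y - z|) ∧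
      ∃ xstar : ℝ, (∀ y : ℝ, f xstar ≤ f y) ∧
      ∃ x₀ : ℝ, x₀ ≠ xstar ∧ ∃ x : ℕ → ℝ, x 0 = x₀ ∧
        (∀ t : ℕ, x (t + 1) = x t - η t * deriv f (x t)) ∧
        (1 / 32) * L * (x₀ - xstar) ^ 2 ≤ f (x (T + 1)) - f xstar := by
  have hf₀ : oneSidedHuber L 0 = 0 := by simp [oneSidedHuber]
  set A := ∑ t ∈ Finset.range T, η t
  rw [div_le_iff₀' hL] at hlong hsum
  have hLA : L * A ≤ L * η T := mul_le_mul_of_nonneg_left hratio hL.le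
  let x : ℕ → ℝ := fun n =>
    Nat.rec (1 + L * A) (fun t y => y - η t * deriv (oneSidedHuber L) y) n
  have hx : ∀ t, x (t + 1) = x t - η t * deriv (oneSidedHuber L) (x t) := fun _ => rfl
  have hxT : x T = 1 := by
    rw [oneSidedHuber_gd_eq hL.le hη rfl hx T le_rfl]
    change 1 + L * A - L * A = 1
    ring
  have hxS : x (T + 1) = 1 - L * η T := by
    rw [hx, hxT, oneSidedHuber.deriv_eq, min_self]
    ring
  refine ⟨oneSidedHuber L, oneSidedHuber.convexOn hL.le, oneSidedHuber.differentiable L,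
    oneSidedHuber.abs_deriv_sub_le hL.le, 0, fun y => hf₀.trans_le (oneSidedHuber.nonneg hL.le y),
    1 + L * A, by linarith, x, rfl, hx, ?_⟩
  rw [hxS, hf₀, oneSidedHuber.eq_of_le_one L (by linarith)]
  have hsq : (1 + L * A) ^ 2 ≤ (4 * (L * η T - 1)) ^ 2 :=
    pow_le_pow_left₀ (by linarith) (by linarith) 2
  nlinarith [mul_le_mul_of_nonneg_left hsq hL.le]

/-- **Corollary 2 (instantiation for silver-like schedules).**
If for infinitely many `T` one has `η T ≥ 2/L`, `∑_{t<T} η t ≥ 1/L`, and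
`(η T / ∑_{t<T} η t)² ≥ 1`, then for infinitely many `S` there exist a convex
`L`-smooth `f : ℝ → ℝ`, a global minimizer `x*`, and an initialization `x₀` such
that the GD iterates satisfy `f (x S) - f x* ≥ (1/32) L (x₀ - x*)²`. -/
theorem gd_frequent_constant_error
    (L : ℝ) (hL : 0 < L) (η : ℕ → ℝ) (hη : ∀ t, 0 ≤ η t)
    (hfreq : ∃ᶠ T in Filter.atTop,
      2 / L ≤ η T ∧ 1 / L ≤ ∑ t ∈ Finset.range T, η t ∧
        1 ≤ (η T / ∑ t ∈ Finset.range T, η t) ^ 2) :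
    ∃ᶠ S in Filter.atTop,
      ∃ f : ℝ → ℝ, ConvexOn ℝ Set.univ f ∧ Differentiable ℝ f ∧
        (∀ y z : ℝ, |deriv f y - deriv f z| ≤ L * |y - z|) ∧
        ∃ xstar : ℝ, (∀ y : ℝ, f xstar ≤ f y) ∧
        ∃ x₀ : ℝ, ∃ x : ℕ → ℝ, x 0 = x₀ ∧
          (∀ t : ℕ, x (t + 1) = x t - η t * deriv f (x t)) ∧
          (1 / 32) * L * (x₀ - xstar) ^ 2 ≤ f (x S) - f xstar := by
  refine (Filter.tendsto_add_atTop_nat 1).frequently (hfreq.mono ?_)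
  rintro T ⟨hlong, hsum, hratio⟩
  have hpos : 0 < ∑ t ∈ Finset.range T, η t := (one_div_pos.2 hL).trans_le hsum
  have hle : ∑ t ∈ Finset.range T, η t ≤ η T := by
    rwa [one_le_sq_iff₀ (div_nonneg (hη T) hpos.le), one_le_div₀ hpos] at hratio
  obtain ⟨f, hconv, hdiff, hlip, xstar, hmin, x₀, -, h⟩ :=
    gd_constant_error_of_long_step hL hη hlong hsum hle
  exact ⟨f, hconv, hdiff, hlip, xstar, hmin, x₀, h⟩
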